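/- Let g : ℝ^d × ℝ^d → ℝ be such that g(·,y) is measurable for each y, g(x,·) is continuous and Y-periodic (period 1 in each coordinate) for a.e. x, and x ↦ sup_{y∈Y} |g(x,y)| is integrable on ℝ^d. Then for every ε > 0 the function (x,y) ↦ g(T_ε(x,y), y) is integrable on ℝ^d × Y and ∫_{ℝ^d} g(x, x/ε) dx = ∫_{ℝ^d} ∫_Y g(T_ε(x,y), y) dy dx. -/

import Mathlib

open MeasureTheory Filter Set

noncomputable section

/-- The unit cell `Y = (0,1]^d`. -/
def Ycell (d : ℕ) : Set (EuclideanSpace ℝ (Fin d)) :=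
  {y | ∀ i, y i ∈ Set.Ioc (0 : ℝ) 1}

/-- The componentwise floor map `N(x) = (⌊x₁⌋, …, ⌊x_d⌋)` (viewed in `ℝ^d`). -/
def Ncell {d : ℕ} (x : EuclideanSpace ℝ (Fin d)) : EuclideanSpace ℝ (Fin d) :=
  WithLp.toLp 2 fun i => (⌊x i⌋ : ℝ)

/-- The two-scale composition function `T_ε(x,y) = ε (N(x/ε) + y)`. -/
def Tcell {d : ℕ} (ε : ℝ) (x y : EuclideanSpace ℝ (Fin d)) :
    EuclideanSpace ℝ (Fin d) :=
  ε • (Ncell (ε⁻¹ • x) + y)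

/-- Interpret a bare vector of `Fin d → ℝ` as an element of `ℝ^d`. -/
def toE {d : ℕ} (v : Fin d → ℝ) : EuclideanSpace ℝ (Fin d) := WithLp.toLp 2 v

/-- The index in `ℤ^d` of the cell `[k, k + 1)^d` containing a point. -/
def floorIndex {d : ℕ} (x : EuclideanSpace ℝ (Fin d)) : Fin d → ℤ := fun i => ⌊x i⌋

/-- The index in `ℤ^d` of the cell `(k, k + 1]^d` containing a point. -/
def ceilIndex {d : ℕ} (x : EuclideanSpace ℝ (Fin d)) : Fin d → ℤ := fun i => ⌈x i⌉ - 1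

lemma measurable_floorIndex {d : ℕ} : Measurable (floorIndex (d := d)) := by
  unfold floorIndex
  fun_prop

lemma measurable_ceilIndex {d : ℕ} : Measurable (ceilIndex (d := d)) := by
  unfold ceilIndex
  refine measurable_pi_lambda _ fun i => ?_
  exact (Int.measurable_ceil.comp (by fun_prop)).sub_const 1

lemma measurable_Ncell {d : ℕ} : Measurable (Ncell (d := d)) := by
  unfold Ncell
  fun_prop

lemma measurable_Tcell {d : ℕ} (ε : ℝ) :
    Measurable fun p : EuclideanSpace ℝ (Fin d) × EuclideanSpace ℝ (Fin d) =>
      Tcell ε p.1 p.2 := by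
  unfold Tcell
  have := (measurable_Ncell (d := d)).comp
    (measurable_fst.const_smul ε⁻¹ :
      Measurable fun p : EuclideanSpace ℝ (Fin d) × EuclideanSpace ℝ (Fin d) => ε⁻¹ • p.1)
  exact (this.add measurable_snd).const_smul ε

lemma measurableSet_Ycell (d : ℕ) : MeasurableSet (Ycell d) := by
  have : Ycell d = ⋂ i, (fun y : EuclideanSpace ℝ (Fin d) => y i) ⁻¹' Set.Ioc (0 : ℝ) 1 := by
    ext y
    simp [Ycell]
  rw [this]
  exact MeasurableSet.iInter fun i => measurableSet_Ioc.preimage (by fun_prop)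

lemma ceilIndex_toE_add_eq_iff {d : ℕ} (k l : Fin d → ℤ) (y : EuclideanSpace ℝ (Fin d)) :
    ceilIndex ((toE fun i => (k i : ℝ)) + y) = l ↔
      y + toE (fun i => ((k i - l i : ℤ) : ℝ)) ∈ Ycell d := by
  simp only [funext_iff, ceilIndex, Ycell, mem_ofPred_eq, toE, PiLp.add_apply, mem_Ioc]
  refine forall_congr' fun i => ?_
  rw [sub_eq_iff_eq_add, Int.ceil_eq_iff]
  push_cast
  constructor <;> rintro ⟨h1, h2⟩ <;> constructor <;> linarith

lemma volume_floorIndex_fiber {d : ℕ} (k : Fin d → ℤ) :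
    volume (floorIndex ⁻¹' {k} : Set (EuclideanSpace ℝ (Fin d))) = 1 := by
  have h : (floorIndex ⁻¹' {k} : Set (EuclideanSpace ℝ (Fin d))) =
      WithLp.ofLp ⁻¹' (Set.univ.pi fun i => Set.Ico (k i : ℝ) (k i + 1)) := by
    ext x
    simp [floorIndex, funext_iff, Int.floor_eq_iff]
  rw [h, (PiLp.volume_preserving_ofLp (Fin d)).measure_preimage
    (MeasurableSet.univ_pi fun i => measurableSet_Ico).nullMeasurableSet, Real.volume_pi_Ico]
  simp

lemma volume_eq_tsum_cells {d : ℕ} {ε : ℝ} (hε : ε ≠ 0) {A : Set (EuclideanSpace ℝ (Fin d))}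
    (hA : MeasurableSet A) :
    volume A = ∑' k : Fin d → ℤ, ENNReal.ofReal |(ε⁻¹ ^ d)⁻¹| *
      volume ({y | ε • ((toE fun i => (k i : ℝ)) + y) ∈ A} ∩ Ycell d) := by
  have hm : Measurable fun x : EuclideanSpace ℝ (Fin d) => ceilIndex (ε⁻¹ • x) :=
    measurable_ceilIndex.comp (measurable_const_smul _)
  have hU : A = ⋃ k, A ∩ (fun x => ceilIndex (ε⁻¹ • x)) ⁻¹' {k} := by
    ext x
    simp
  conv_lhs => rw [hU]
  rw [measure_iUnion]
  · refine tsum_congr fun k => ?_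
    have h1 : A ∩ (fun x => ceilIndex (ε⁻¹ • x)) ⁻¹' {k} =
        (ε⁻¹ • ·) ⁻¹' {w | ε • w ∈ A ∧ ceilIndex w = k} := by
      ext x
      simp [smul_smul, hε]
    have h2 : {y | ε • ((toE fun i => (k i : ℝ)) + y) ∈ A} ∩ Ycell d =
        ((toE fun i => (k i : ℝ)) + ·) ⁻¹' {w | ε • w ∈ A ∧ ceilIndex w = k} := by
      ext y
      have h0 : toE (fun _ : Fin d => (0 : ℝ)) = 0 := rfl
      simp [ceilIndex_toE_add_eq_iff, h0]
    rw [h1, h2, Measure.addHaar_preimage_smul _ (inv_ne_zero hε), measure_preimage_add,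
      finrank_euclideanSpace_fin]
  · intro k l hkl
    refine Disjoint.mono inter_subset_right inter_subset_right ?_
    exact Disjoint.preimage _ (by simpa using hkl)
  · exact fun k => hA.inter (hm (measurableSet_singleton k))

lemma measurePreserving_Tcell {d : ℕ} {ε : ℝ} (hε : ε ≠ 0) :
    MeasurePreserving (fun p : EuclideanSpace ℝ (Fin d) × EuclideanSpace ℝ (Fin d) =>
      Tcell ε p.1 p.2) (volume.prod (volume.restrict (Ycell d))) volume := by
  refine ⟨measurable_Tcell ε, Measure.ext fun A hA => ?_⟩
  have hm : Measurable fun x : EuclideanSpace ℝ (Fin d) => floorIndex (ε⁻¹ • x) :=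
    measurable_floorIndex.comp (measurable_const_smul _)
  rw [Measure.map_apply (measurable_Tcell ε) hA, Measure.prod_apply (measurable_Tcell ε hA),
    volume_eq_tsum_cells hε hA]
  let h : (Fin d → ℤ) → ENNReal := fun k =>
    volume ({y | ε • ((toE fun i => (k i : ℝ)) + y) ∈ A} ∩ Ycell d)
  have key : ∀ x : EuclideanSpace ℝ (Fin d), volume.restrict (Ycell d)
      (Prod.mk x ⁻¹' ((fun p : EuclideanSpace ℝ (Fin d) × EuclideanSpace ℝ (Fin d) =>
        Tcell ε p.1 p.2) ⁻¹' A)) = h (floorIndex (ε⁻¹ • x)) := fun x =>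
    Measure.restrict_apply' (measurableSet_Ycell d)
  simp_rw [key]
  rw [← lintegral_map (f := h) .of_discrete hm, lintegral_countable']
  refine tsum_congr fun k => ?_
  rw [Measure.map_apply hm (measurableSet_singleton k), mul_comm]
  congr 1
  have := Measure.addHaar_preimage_smul (volume : Measure (EuclideanSpace ℝ (Fin d)))
    (inv_ne_zero hε) (floorIndex ⁻¹' {k})
  rw [volume_floorIndex_fiber, mul_one, finrank_euclideanSpace_fin] at this
  exact this

lemma abs_le_iSup_Ycell {d : ℕ} {f : EuclideanSpace ℝ (Fin d) → ℝ} (hf : Continuous f)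
    (hper : ∀ (y : EuclideanSpace ℝ (Fin d)) (k : Fin d → ℤ),
      f (y + toE fun i => (k i : ℝ)) = f y) (z : EuclideanSpace ℝ (Fin d)) :
    |f z| ≤ ⨆ y ∈ Ycell d, |f y| := by
  obtain ⟨y, hy, hyz⟩ : ∃ y ∈ Ycell d, f y = f z := by
    refine ⟨_, ?_, hper z fun i => -ceilIndex z i⟩
    intro i
    have h1 := Int.ceil_lt_add_one (z i)
    have h2 := Int.le_ceil (z i)
    simp only [toE, ceilIndex, PiLp.add_apply, mem_Ioc]
    push_cast
    constructor <;> linarith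
  have hK : IsCompact (WithLp.toLp 2 '' Set.Icc (0 : Fin d → ℝ) 1) :=
    isCompact_Icc.image (PiLp.continuous_toLp 2 _)
  obtain ⟨M, hM⟩ := hK.bddAbove_image hf.abs.continuousOn
  have hle : ∀ y ∈ Ycell d, |f y| ≤ M := fun y hy =>
    hM ⟨y, ⟨y.ofLp, ⟨fun i => (hy i).1.le, fun i => (hy i).2⟩, rfl⟩, rfl⟩
  have hM0 : 0 ≤ M := (abs_nonneg _).trans (hle y hy)
  have hb : BddAbove (range fun y => ⨆ _ : y ∈ Ycell d, |f y|) := by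
    refine ⟨M, ?_⟩
    rintro _ ⟨y, rfl⟩
    exact Real.iSup_le (hle y) hM0
  rw [← hyz]
  refine le_ciSup_of_le hb y ?_
  simp [hy]

lemma aestronglyMeasurable_of_ae_continuous_right {α β : Type*} [MeasurableSpace α]
    [TopologicalSpace β] [TopologicalSpace.MetrizableSpace β] [SecondCountableTopology β]
    [MeasurableSpace β] [OpensMeasurableSpace β] {μ : Measure α}
    {g : α → β → ℝ} (hmeas : ∀ y, Measurable fun x => g x y)
    (hcont : ∀ᵐ x ∂μ, Continuous (g x)) {φ : α → β} (hφ : Measurable φ) :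
    AEStronglyMeasurable (fun x => g x (φ x)) μ := by
  let S := toMeasurable μ {x | ¬ Continuous (g x)}
  have hS : MeasurableSet S := measurableSet_toMeasurable _ _
  have hS0 : μ S = 0 := (measure_toMeasurable _).trans hcont
  let g' : β → α → ℝ := fun y => Sᶜ.indicator fun x => g x y
  have hg' : Measurable fun p : α × β => g' p.2 p.1 := by
    refine (measurable_uncurry_of_continuous_of_measurable (u := g') (fun x => ?_)
      fun y => (hmeas y).indicator hS.compl).comp measurable_swap
    by_cases hx : x ∈ S
    · simpa [g', hx] using continuous_const
    · have : Continuous (g x) := by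
        by_contra h
        exact hx (subset_toMeasurable _ _ h)
      simpa [g', hx] using this
  refine ⟨fun x => g' (φ x) x, (hg'.comp (measurable_id.prodMk hφ)).stronglyMeasurable, ?_⟩
  filter_upwards [measure_eq_zero_iff_ae_notMem.1 hS0] with x hx
  simp [g', hx]

/-- two-scale decomposition of integrals: if `g(·,y)` is measurable for
each `y`, `g(x,·)` is continuous and `Y`-periodic for a.e. `x`, and
`x ↦ sup_{y ∈ Y} |g(x,y)|` is integrable, then for every `ε > 0` the function
`(x,y) ↦ g(T_ε(x,y), y)` is integrable on `ℝ^d × Y` and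
`∫_{ℝ^d} g(x, x/ε) dx = ∫_{ℝ^d} ∫_Y g(T_ε(x,y), y) dy dx`. -/
theorem stmt1 {d : ℕ} (hd : 1 ≤ d)
    (g : EuclideanSpace ℝ (Fin d) → EuclideanSpace ℝ (Fin d) → ℝ)
    (hmeas : ∀ y, Measurable fun x => g x y)
    (hcontper : ∀ᵐ x : EuclideanSpace ℝ (Fin d),
      Continuous (g x) ∧
      ∀ (y : EuclideanSpace ℝ (Fin d)) (k : Fin d → ℤ),
        g x (y + toE fun i => (k i : ℝ)) = g x y)
    (hint : Integrable fun x : EuclideanSpace ℝ (Fin d) => ⨆ y ∈ Ycell d, |g x y|)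
    (ε : ℝ) (hε : 0 < ε) :
    IntegrableOn
      (fun p : EuclideanSpace ℝ (Fin d) × EuclideanSpace ℝ (Fin d) =>
        g (Tcell ε p.1 p.2) p.2) (Set.univ ×ˢ Ycell d) ∧
    ∫ x : EuclideanSpace ℝ (Fin d), g x (ε⁻¹ • x) =
      ∫ x : EuclideanSpace ℝ (Fin d), ∫ y in Ycell d, g (Tcell ε x y) y := by
  have hε0 : ε ≠ 0 := hε.ne'
  have hT := measurePreserving_Tcell (d := d) hε0
  have hG : Integrable fun x : EuclideanSpace ℝ (Fin d) => g x (ε⁻¹ • x) := by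
    refine hint.mono' (aestronglyMeasurable_of_ae_continuous_right hmeas
      (hcontper.mono fun x hx => hx.1) (measurable_const_smul _)) ?_
    filter_upwards [hcontper] with x hx
    exact abs_le_iSup_Ycell hx.1 hx.2 _
  have hEq : (fun p : EuclideanSpace ℝ (Fin d) × EuclideanSpace ℝ (Fin d) =>
      g (Tcell ε p.1 p.2) (ε⁻¹ • Tcell ε p.1 p.2)) =ᵐ[volume.prod (volume.restrict (Ycell d))]
      fun p => g (Tcell ε p.1 p.2) p.2 := by
    filter_upwards [hT.quasiMeasurePreserving.ae hcontper] with p hp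
    have : ε⁻¹ • Tcell ε p.1 p.2 = p.2 + toE fun i => (floorIndex (ε⁻¹ • p.1) i : ℝ) := by
      rw [Tcell, smul_smul, inv_mul_cancel₀ hε0, one_smul, add_comm]
      rfl
    rw [this, hp.2]
  have hI : Integrable (fun p : EuclideanSpace ℝ (Fin d) × EuclideanSpace ℝ (Fin d) =>
      g (Tcell ε p.1 p.2) p.2) (volume.prod (volume.restrict (Ycell d))) :=
    (hT.integrable_comp_of_integrable hG).congr hEq
  refine ⟨?_, ?_⟩
  · rwa [IntegrableOn, Measure.volume_eq_prod, ← Measure.prod_restrict, Measure.restrict_univ]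
  · rw [← integral_prod _ hI, ← integral_congr_ae hEq]
    have hG' := hG.1
    rw [← hT.map_eq] at hG'
    have := integral_map hT.aemeasurable hG'
    rwa [hT.map_eq] at this
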